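/- For any two subsets S₁ and S₂ of the customer set {1,…,n} and any unitary cost c ≥ 0 such that G(S₁,c) = G(S₂,c), one has G(S₁,c) ≤ max(G(S₁ ∪ S₂,c), G(S₁ ∩ S₂,c)). -/

import Mathlib

open Finset

/-- Expected revenue of a set of customers. -/
def R (pi p : ℕ → ℝ) (S : Finset ℕ) : ℝ := ∑ i ∈ S, pi i * p i

/-- Expected traveled distance (with l i = 2 * x i). -/
def L (x pi : ℕ → ℝ) (S : Finset ℕ) : ℝ :=
  ∑ i ∈ S, (2 * x i) * pi i * ∏ j ∈ S.filter (fun j => i < j), (1 - pi j)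

/-- Expected profit at unitary cost c. -/
def G (x pi p : ℕ → ℝ) (S : Finset ℕ) (c : ℝ) : ℝ := R pi p S - c * L x pi S

/-- Optimal value of the probabilistic profitable tour problem on a line. -/
def PPTP (n : ℕ) (x pi p : ℕ → ℝ) (c : ℝ) : ℝ :=
  (Finset.Icc 1 n).powerset.sup' (Finset.powerset_nonempty _) (fun S => G x pi p S c)

lemma L_empty (x pi : ℕ → ℝ) : L x pi ∅ = 0 := by
  simp [L]

lemma L_insert_of_forall_lt (x pi : ℕ → ℝ) {a : ℕ} {S : Finset ℕ} (h : ∀ i ∈ S, i < a) :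
    L x pi (insert a S) = 2 * x a * pi a + (1 - pi a) * L x pi S := by
  have ha : a ∉ S := fun hS => lt_irrefl a (h a hS)
  have hempty : (insert a S).filter (fun j => a < j) = ∅ := by
    ext j
    simp only [mem_filter, mem_insert, notMem_empty, iff_false, not_and, not_lt]
    rintro (rfl | hj)
    · exact le_rfl
    · exact (h j hj).le
  unfold L
  rw [sum_insert ha, hempty, prod_empty, mul_one, mul_sum]
  congr 1
  refine sum_congr rfl fun i hi => ?_
  rw [filter_insert, if_pos (h i hi), prod_insert (by simp [ha])]
  ring

lemma L_le_of_forall_le {x pi : ℕ → ℝ} {y : ℝ} (hy : 0 ≤ y) (S : Finset ℕ)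
    (hpi : ∀ i ∈ S, 0 ≤ pi i ∧ pi i ≤ 1) (hx : ∀ i ∈ S, x i ≤ y) :
    L x pi S ≤ 2 * y := by
  induction S using Finset.induction_on_max with
  | empty => rw [L_empty]; positivity
  | insert a S ha ih =>
    rw [L_insert_of_forall_lt x pi ha]
    have hS := ih (fun i hi => hpi i (mem_insert_of_mem hi))
      (fun i hi => hx i (mem_insert_of_mem hi))
    obtain ⟨h0, h1⟩ := hpi a (mem_insert_self a S)
    have hxa := hx a (mem_insert_self a S)
    nlinarith [mul_le_mul_of_nonneg_right hxa h0,
      mul_le_mul_of_nonneg_left hS (sub_nonneg.2 h1)]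

lemma subset_or_eq_insert_of_subset_insert {a : ℕ} {S T : Finset ℕ} (h : S ⊆ insert a T) :
    S ⊆ T ∨ ∃ A ⊆ T, S = insert a A := by
  by_cases ha : a ∈ S
  · exact .inr ⟨S.erase a, subset_insert_iff.1 h, (insert_erase ha).symm⟩
  · exact .inl ((subset_insert_iff_of_notMem ha).1 h)

lemma L_mono {x pi : ℕ → ℝ} (T : Finset ℕ) (hpi : ∀ i ∈ T, 0 ≤ pi i ∧ pi i ≤ 1)
    (hx : ∀ i ∈ T, 0 ≤ x i) (hmono : MonotoneOn x T) {A B : Finset ℕ} (hB : B ⊆ T)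
    (hAB : A ⊆ B) : L x pi A ≤ L x pi B := by
  induction T using Finset.induction_on_max generalizing A B with
  | empty =>
    obtain rfl := subset_empty.1 hB
    obtain rfl := subset_empty.1 hAB
    exact le_rfl
  | insert a T ha ih =>
    have hpiT : ∀ i ∈ T, 0 ≤ pi i ∧ pi i ≤ 1 := fun i hi => hpi i (mem_insert_of_mem hi)
    replace ih := @ih hpiT (fun i hi => hx i (mem_insert_of_mem hi))
      (hmono.mono (by simp))
    obtain ⟨h0, h1⟩ := hpi a (mem_insert_self a T)
    rcases subset_or_eq_insert_of_subset_insert hB with hBT | ⟨B, hBT, rfl⟩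
    · exact ih hBT hAB
    rw [L_insert_of_forall_lt x pi fun i hi => ha i (hBT hi)]
    rcases subset_or_eq_insert_of_subset_insert hAB with hAB' | ⟨A, hAB', rfl⟩
    · have hL : L x pi B ≤ 2 * x a :=
        L_le_of_forall_le (hx a (mem_insert_self a T)) B (fun i hi => hpiT i (hBT hi))
          fun i hi => hmono (by simp [hBT hi]) (by simp) (ha i (hBT hi)).le
      nlinarith [ih hBT hAB', mul_le_mul_of_nonneg_left hL h0]
    · rw [L_insert_of_forall_lt x pi fun i hi => ha i (hBT (hAB' hi))]
      have := mul_le_mul_of_nonneg_left (ih hBT hAB') (sub_nonneg.2 h1)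
      linarith

/-- The expected traveled distance is submodular. -/
lemma L_union_add_L_inter_le {x pi : ℕ → ℝ} (T : Finset ℕ)
    (hpi : ∀ i ∈ T, 0 ≤ pi i ∧ pi i ≤ 1) (hx : ∀ i ∈ T, 0 ≤ x i) (hmono : MonotoneOn x T)
    {A B : Finset ℕ} (hA : A ⊆ T) (hB : B ⊆ T) :
    L x pi (A ∪ B) + L x pi (A ∩ B) ≤ L x pi A + L x pi B := by
  induction T using Finset.induction_on_max generalizing A B with
  | empty =>
    obtain rfl := subset_empty.1 hA
    obtain rfl := subset_empty.1 hB
    simp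
  | insert a T ha ih =>
    have haT : a ∉ T := fun h => lt_irrefl a (ha a h)
    have hpiT : ∀ i ∈ T, 0 ≤ pi i ∧ pi i ≤ 1 := fun i hi => hpi i (mem_insert_of_mem hi)
    have hxT : ∀ i ∈ T, 0 ≤ x i := fun i hi => hx i (mem_insert_of_mem hi)
    have hmonoT : MonotoneOn x T := hmono.mono (by simp)
    replace ih := @ih hpiT hxT hmonoT
    obtain ⟨h0, h1⟩ := hpi a (mem_insert_self a T)
    have hins : ∀ {S : Finset ℕ}, S ⊆ T →
        L x pi (insert a S) = 2 * x a * pi a + (1 - pi a) * L x pi S :=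
      fun hS => L_insert_of_forall_lt x pi fun i hi => ha i (hS hi)
    rcases subset_or_eq_insert_of_subset_insert hA with hAT | ⟨A, hAT, rfl⟩ <;>
      rcases subset_or_eq_insert_of_subset_insert hB with hBT | ⟨B, hBT, rfl⟩
    · exact ih hAT hBT
    · rw [union_insert, inter_insert_of_notMem (fun h => haT (hAT h)), hins (union_subset hAT hBT),
        hins hBT]
      have hle := L_mono T hpiT hxT hmonoT hAT (inter_subset_left (s₂ := B))
      nlinarith [mul_le_mul_of_nonneg_left (ih hAT hBT) (sub_nonneg.2 h1),
        mul_le_mul_of_nonneg_left hle h0]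
    · rw [insert_union, insert_inter_of_notMem (fun h => haT (hBT h)), hins (union_subset hAT hBT),
        hins hAT]
      have hle := L_mono T hpiT hxT hmonoT hBT (inter_subset_right (s₁ := A))
      nlinarith [mul_le_mul_of_nonneg_left (ih hAT hBT) (sub_nonneg.2 h1),
        mul_le_mul_of_nonneg_left hle h0]
    · rw [← insert_union_distrib, ← insert_inter_distrib, hins (union_subset hAT hBT),
        hins (inter_subset_left.trans hAT), hins hAT, hins hBT]
      nlinarith [mul_le_mul_of_nonneg_left (ih hAT hBT) (sub_nonneg.2 h1)]

theorem stmt7 (n : ℕ) (x p pi : ℕ → ℝ)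
    (hx : ∀ i ∈ Finset.Icc 1 n, 0 < x i)
    (hxmono : ∀ i, 1 ≤ i → i + 1 ≤ n → x i ≤ x (i + 1))
    (hp : ∀ i ∈ Finset.Icc 1 n, 0 < p i)
    (hpi : ∀ i ∈ Finset.Icc 1 n, 0 < pi i ∧ pi i ≤ 1)
    (S₁ S₂ : Finset ℕ) (hS₁ : S₁ ⊆ Finset.Icc 1 n) (hS₂ : S₂ ⊆ Finset.Icc 1 n)
    (c : ℝ) (hc : 0 ≤ c) (heq : G x pi p S₁ c = G x pi p S₂ c) :
    G x pi p S₁ c ≤ max (G x pi p (S₁ ∪ S₂) c) (G x pi p (S₁ ∩ S₂) c) := by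
  have hmono : MonotoneOn x (Finset.Icc 1 n : Finset ℕ) := by
    intro i hi j hj hij
    simp only [coe_Icc, Set.mem_Icc] at hi hj
    obtain ⟨-, hjn⟩ := hj
    induction j, hij using Nat.le_induction with
    | base => exact le_rfl
    | succ k hik ih => exact (ih (by omega)).trans (hxmono k (by omega) hjn)
  have hL := L_union_add_L_inter_le (Finset.Icc 1 n)
    (fun i hi => ⟨(hpi i hi).1.le, (hpi i hi).2⟩) (fun i hi => (hx i hi).le) hmono hS₁ hS₂
  have hR : R pi p (S₁ ∪ S₂) + R pi p (S₁ ∩ S₂) = R pi p S₁ + R pi p S₂ := sum_union_inter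
  have hcL := mul_le_mul_of_nonneg_left hL hc
  rw [le_max_iff]
  unfold G at *
  by_contra! h
  linarith [h.1, h.2]
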